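/- Let G be a position with exactly one 3-chain, with size(G) ≡ 3 (mod 4) and c(G) < 2. If G contains a 4-loop, then opening a 4-loop is optimal. Regardless of whether G contains a 4-loop: if c(G) + 4·f(G) ≥ 2, then v(G) = 1 or 3 according to whether c(G) ≡ ±1 or ±3 (mod 8); while if c(G) + 4·f(G) < 2, then v(G) = 1 or 3 according to whether f(G) is odd or even. -/

import Mathlib

namespace DotsAndBoxes

/-- A component of a Dots & Boxes endgame position: an `n`-chain or an `n`-loop. -/
inductive Component : Type where
  | chain (n : ℕ)
  | loop (n : ℕ)
deriving DecidableEq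

namespace Component

/-- The number of boxes in a component. -/
def size : Component → ℕ
  | chain n => n
  | loop n => n

def isChain : Component → Bool
  | chain _ => true
  | loop _ => false

def isLoop : Component → Bool
  | chain _ => false
  | loop _ => true

/-- A chain must have length at least 3; a loop must have even length at least 4. -/
def Valid : Component → Prop
  | chain n => 3 ≤ n
  | loop n => 4 ≤ n ∧ Even n

end Component

/-- A position is a finite multiset of components. -/
abbrev Position := Multiset Component

def Position.Valid (G : Position) : Prop := ∀ C ∈ G, C.Valid

/-- The number of unclaimed boxes in a position. -/
def size (G : Position) : ℕ := (G.map Component.size).sum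

/-- The number of chains of a position. -/
def numChains (G : Position) : ℕ := Multiset.card (G.filter fun C => C.isChain = true)

/-- The number of loops of a position. -/
def numLoops (G : Position) : ℕ := Multiset.card (G.filter fun C => C.isLoop = true)

/-- θ(G), the number of 3-chains. -/
def theta (G : Position) : ℕ := G.count (Component.chain 3)

/-- f(G), the number of 4-loops. -/
def numF (G : Position) : ℕ := G.count (Component.loop 4)

/-- s(G), the number of 6-loops. -/
def numS (G : Position) : ℕ := G.count (Component.loop 6)

open Classical in
/-- The terminal bonus tb(G). -/
noncomputable def tb (G : Position) : ℤ :=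
  if G = 0 then 0
  else if ∀ C ∈ G, C.isLoop = true then 8
  else if (∃ C ∈ G, C.isLoop = true) ∧ Component.chain 3 ∈ G ∧
      (∀ C ∈ G, C.isChain = true → C = Component.chain 3) then 6
  else 4

/-- The controlled value c(G). -/
noncomputable def cval (G : Position) : ℤ :=
  (size G : ℤ) - 4 * (numChains G : ℤ) - 8 * (numLoops G : ℤ) + tb G

/-- The score v(G;C) of opening component `C`, given that the remainder of the
position has value `w`. -/
def openVal (C : Component) (w : ℤ) : ℤ :=
  match C with
  | Component.chain n => ((n : ℤ) - 2) + |w - 2|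
  | Component.loop n => ((n : ℤ) - 4) + |w - 4|

/-- Auxiliary recursion (on the number of components) for the value `v`. -/
noncomputable def valueAux : ℕ → Position → ℤ
  | 0, _ => 0
  | n + 1, G =>
    if G = 0 then 0
    else sInf { x : ℤ | ∃ C ∈ G, x = openVal C (valueAux n (G.erase C)) }

/-- The value v(G): v(∅) = 0, and v(G) = min over components C of G of v(G;C). -/
noncomputable def value (G : Position) : ℤ := valueAux (Multiset.card G) G

/-- v(G;C), the value of G given that the opener has just opened C. -/
noncomputable def valueOpen (G : Position) (C : Component) : ℤ :=
  openVal C (value (G.erase C))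

/-- Opening a component C of G is optimal if C ∈ G and v(G;C) = v(G). -/
def Optimal (G : Position) (C : Component) : Prop :=
  C ∈ G ∧ valueOpen G C = value G



open Component

/-! ### Basic recursion for the value -/

lemma openVal_nonneg {C : Component} (hC : C.Valid) (w : ℤ) : 0 ≤ openVal C w := by
  cases C with
  | chain n =>
    have h : 3 ≤ n := hC
    have := abs_nonneg (w - 2)
    simp only [openVal]; omega
  | loop n =>
    have h : 4 ≤ n := hC.1
    have := abs_nonneg (w - 4)
    simp only [openVal]; omega

lemma value_zero : value 0 = 0 := by simp [value, valueAux]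

lemma value_set {G : Position} (h0 : G ≠ 0) :
    value G = sInf { x : ℤ | ∃ C ∈ G, x = openVal C (value (G.erase C)) } := by
  obtain ⟨n, hn⟩ : ∃ n, Multiset.card G = n + 1 :=
    Nat.exists_eq_succ_of_ne_zero (by simpa using h0)
  have hset : { x : ℤ | ∃ C ∈ G, x = openVal C (valueAux n (G.erase C)) } =
      { x : ℤ | ∃ C ∈ G, x = openVal C (value (G.erase C)) } := by
    ext x
    simp only [Set.mem_ofPred_eq]
    refine exists_congr fun C => and_congr_right fun hC => ?_
    have : Multiset.card (G.erase C) = n := by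
      rw [Multiset.card_erase_of_mem hC, hn]; rfl
    rw [value, this]
  rw [value, hn, valueAux, if_neg h0, hset]

lemma value_bdd {G : Position} (hG : G.Valid) :
    BddBelow { x : ℤ | ∃ C ∈ G, x = openVal C (value (G.erase C)) } :=
  ⟨0, by rintro x ⟨C, hC, rfl⟩; exact openVal_nonneg (hG C hC) _⟩

lemma value_le {G : Position} (hG : G.Valid) {C : Component} (hC : C ∈ G) :
    value G ≤ openVal C (value (G.erase C)) := by
  have h0 : G ≠ 0 := by rintro rfl; simp at hC
  rw [value_set h0]
  exact csInf_le (value_bdd hG) ⟨C, hC, rfl⟩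

lemma value_exists {G : Position} (hG : G.Valid) (h0 : G ≠ 0) :
    ∃ C ∈ G, value G = openVal C (value (G.erase C)) := by
  rw [value_set h0]
  obtain ⟨C, hC⟩ := Multiset.exists_mem_of_ne_zero h0
  have hne : { x : ℤ | ∃ C ∈ G, x = openVal C (value (G.erase C)) }.Nonempty :=
    ⟨openVal C (value (G.erase C)), ⟨C, hC, rfl⟩⟩
  exact Int.csInf_mem hne (value_bdd hG)

lemma abs_two (w : ℤ) : |w - 2| = max (w - 2) (2 - w) := by
  rw [abs_eq_max_neg, neg_sub]

lemma abs_four (w : ℤ) : |w - 4| = max (w - 4) (4 - w) := by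
  rw [abs_eq_max_neg, neg_sub]

lemma valid_cons {C : Component} {R : Position} :
    Position.Valid (C ::ₘ R) ↔ C.Valid ∧ R.Valid := by
  simp [Position.Valid]

lemma value_le_chain {n : ℕ} {R : Position} (h : Position.Valid (chain n ::ₘ R)) :
    value (chain n ::ₘ R) ≤ (n : ℤ) - 2 + max (value R - 2) (2 - value R) := by
  have := value_le h (Multiset.mem_cons_self _ _)
  rwa [Multiset.erase_cons_head, openVal, abs_two] at this

lemma value_le_loop {n : ℕ} {R : Position} (h : Position.Valid (loop n ::ₘ R)) :
    value (loop n ::ₘ R) ≤ (n : ℤ) - 4 + max (value R - 4) (4 - value R) := by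
  have := value_le h (Multiset.mem_cons_self _ _)
  rwa [Multiset.erase_cons_head, openVal, abs_four] at this

lemma value_cases {G : Position} (hG : G.Valid) (h0 : G ≠ 0) :
    (∃ (n : ℕ) (R : Position), G = chain n ::ₘ R ∧ 3 ≤ n ∧ R.Valid ∧
      value G = (n : ℤ) - 2 + max (value R - 2) (2 - value R)) ∨
    (∃ (n : ℕ) (R : Position), G = loop n ::ₘ R ∧ 4 ≤ n ∧ n % 2 = 0 ∧ R.Valid ∧
      value G = (n : ℤ) - 4 + max (value R - 4) (4 - value R)) := by
  obtain ⟨C, hC, hv⟩ := value_exists hG h0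
  obtain ⟨R, rfl⟩ := Multiset.exists_cons_of_mem hC
  rw [Multiset.erase_cons_head] at hv
  rw [valid_cons] at hG
  cases C with
  | chain n =>
    left
    rw [openVal, abs_two] at hv
    exact ⟨n, R, rfl, hG.1, hG.2, hv⟩
  | loop n =>
    right
    rw [openVal, abs_four] at hv
    exact ⟨n, R, rfl, hG.1.1, Nat.even_iff.mp hG.1.2, hG.2, hv⟩

lemma value_nonneg {G : Position} (hG : G.Valid) : 0 ≤ value G := by
  by_cases h0 : G = 0
  · rw [h0, value_zero]
  · obtain ⟨C, hC, hv⟩ := value_exists hG h0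
    rw [hv]; exact openVal_nonneg (hG C hC) _

/-! ### Counting functions on `C ::ₘ R` -/

@[simp] lemma size_zero : size 0 = 0 := by simp [size]
@[simp] lemma size_chain (n : ℕ) (R : Position) : size (chain n ::ₘ R) = n + size R := by
  simp [size, Component.size]
@[simp] lemma size_loop (n : ℕ) (R : Position) : size (loop n ::ₘ R) = n + size R := by
  simp [size, Component.size]
@[simp] lemma theta_zero : theta 0 = 0 := by simp [theta]
@[simp] lemma theta_loop (n : ℕ) (R : Position) : theta (loop n ::ₘ R) = theta R := by
  simp [theta, Multiset.count_cons]
lemma theta_chain (n : ℕ) (R : Position) :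
    theta (chain n ::ₘ R) = theta R + if n = 3 then 1 else 0 := by
  simp [theta, Multiset.count_cons, eq_comm]
@[simp] lemma numF_loop4 (R : Position) : numF (loop 4 ::ₘ R) = numF R + 1 := by
  simp [numF]

/-- Controlled value without the terminal bonus. -/
def base (G : Position) : ℤ :=
  (size G : ℤ) - 4 * (numChains G : ℤ) - 8 * (numLoops G : ℤ)

lemma cval_eq (G : Position) : cval G = base G + tb G := rfl

@[simp] lemma base_zero : base 0 = 0 := by simp [base, numChains, numLoops]
@[simp] lemma base_chain (n : ℕ) (R : Position) :
    base (chain n ::ₘ R) = base R + n - 4 := by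
  have h1 : numChains (chain n ::ₘ R) = numChains R + 1 := by
    rw [numChains, Multiset.filter_cons_of_pos _ (by simp [isChain]), Multiset.card_cons, numChains]
  have h2 : numLoops (chain n ::ₘ R) = numLoops R := by
    rw [numLoops, Multiset.filter_cons_of_neg _ (by simp [isLoop]), numLoops]
  rw [base, base, h1, h2, size_chain]; push_cast; ring
@[simp] lemma base_loop (n : ℕ) (R : Position) :
    base (loop n ::ₘ R) = base R + n - 8 := by
  have h1 : numChains (loop n ::ₘ R) = numChains R := by
    rw [numChains, Multiset.filter_cons_of_neg _ (by simp [isChain]), numChains]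
  have h2 : numLoops (loop n ::ₘ R) = numLoops R + 1 := by
    rw [numLoops, Multiset.filter_cons_of_pos _ (by simp [isLoop]), Multiset.card_cons, numLoops]
  rw [base, base, h1, h2, size_loop]; push_cast; ring

lemma base_mod (G : Position) : (4 : ℤ) ∣ base G - size G :=
  ⟨-(numChains G : ℤ) - 2 * numLoops G, by simp only [base]; ring⟩

/-- All components are loops. -/
def AllLoops (G : Position) : Prop := ∀ C ∈ G, C.isLoop = true

lemma allLoops_loop (n : ℕ) (R : Position) : AllLoops (loop n ::ₘ R) ↔ AllLoops R := by
  simp [AllLoops, isLoop]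

lemma not_allLoops_chain (n : ℕ) (R : Position) : ¬ AllLoops (chain n ::ₘ R) := by
  simp [AllLoops, isLoop]

lemma allLoops_theta {G : Position} (h : AllLoops G) : theta G = 0 := by
  rw [theta, Multiset.count_eq_zero]
  intro hm
  have := h _ hm
  simp [isLoop] at this

lemma tb_zero : tb 0 = 0 := by simp [tb]

lemma tb_allLoops {G : Position} (h0 : G ≠ 0) (h : AllLoops G) : tb G = 8 := by
  unfold AllLoops at h
  rw [tb, if_neg h0, if_pos h]

lemma tb_four {G : Position} (h : ¬ AllLoops G) (ht : theta G = 0) : tb G = 4 := by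
  have h0 : G ≠ 0 := by rintro rfl; simp [AllLoops] at h
  unfold AllLoops at h
  rw [theta, Multiset.count_eq_zero] at ht
  rw [tb, if_neg h0, if_neg h, if_neg]
  tauto

/-- A 3-chain together with a nonempty collection of loops. -/
lemma tb_six {R : Position} (h0 : R ≠ 0) (h : AllLoops R) : tb (chain 3 ::ₘ R) = 6 := by
  have h1 := not_allLoops_chain 3 R
  unfold AllLoops at h1
  rw [tb, if_neg (Multiset.cons_ne_zero), if_neg h1, if_pos]
  obtain ⟨C, hC⟩ := Multiset.exists_mem_of_ne_zero h0
  refine ⟨⟨C, Multiset.mem_cons_of_mem hC, h C hC⟩, Multiset.mem_cons_self _ _, ?_⟩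
  intro D hD hc
  rcases Multiset.mem_cons.mp hD with rfl | hD
  · rfl
  · have := h D hD
    cases D <;> simp [isLoop, isChain] at *

lemma tb_three : tb (chain 3 ::ₘ 0) = 4 := by
  have h1 := not_allLoops_chain 3 0
  unfold AllLoops at h1
  rw [tb, if_neg (Multiset.cons_ne_zero), if_neg h1, if_neg]
  simp [isLoop]

/-- One 3-chain, together with some other chains of length at least 4. -/
lemma tb_mixed {R : Position} (h : ¬ AllLoops R) (ht : theta R = 0) :
    tb (chain 3 ::ₘ R) = 4 := by
  have h1 := not_allLoops_chain 3 R
  unfold AllLoops at h1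
  rw [tb, if_neg (Multiset.cons_ne_zero), if_neg h1, if_neg]
  rintro ⟨-, -, h3⟩
  unfold AllLoops at h
  push Not at h
  obtain ⟨C, hC, hl⟩ := h
  have hc : C.isChain = true := by cases C <;> simp [isLoop, isChain] at *
  have := h3 C (Multiset.mem_cons_of_mem hC) hc
  rw [theta, Multiset.count_eq_zero] at ht
  exact ht (this ▸ hC)

lemma theta_one {G : Position} (h : theta G = 1) :
    ∃ R, G = chain 3 ::ₘ R ∧ theta R = 0 := by
  have : chain 3 ∈ G := by
    rw [theta] at h
    exact Multiset.count_pos.mp (by omega)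
  obtain ⟨R, rfl⟩ := Multiset.exists_cons_of_mem this
  exact ⟨R, rfl, by rw [theta_chain] at h; simpa using h⟩

lemma value_three : value (chain 3 ::ₘ 0) = 3 := by
  have hv : Position.Valid (chain 3 ::ₘ 0) := by simp [Position.Valid, Component.Valid]
  rcases value_cases hv Multiset.cons_ne_zero with ⟨n, R, h, -, -, h2⟩ | ⟨n, R, h, -⟩
  · have h3 : Multiset.card R = 0 := by
      have := congrArg Multiset.card h; simpa using this
    rw [Multiset.card_eq_zero] at h3
    subst h3
    have := congrArg size h
    rw [size_chain, size_chain, size_zero] at this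
    obtain rfl : n = 3 := by omega
    rw [h2, value_zero]; norm_num
  · have : loop n ∈ (chain 3 ::ₘ 0 : Position) := by rw [h]; simp
    simp at this

/-! ### Parity -/

lemma value_parity : ∀ (k : ℕ) (G : Position), Multiset.card G = k → G.Valid →
    value G % 2 = (size G : ℤ) % 2 := by
  intro k
  induction k with
  | zero =>
    intro G hk _
    rw [Multiset.card_eq_zero] at hk
    subst hk; simp [value_zero]
  | succ k ih =>
    intro G hk hG
    have h0 : G ≠ 0 := by rintro rfl; simp at hk
    rcases value_cases hG h0 with ⟨n, R, rfl, h1, hR, h2⟩ | ⟨n, R, rfl, h1, h3, hR, h2⟩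
    · have := ih R (by simpa using hk) hR
      rw [size_chain]; push_cast; omega
    · have := ih R (by simpa using hk) hR
      rw [size_loop]; push_cast; omega

lemma parity {G : Position} (hG : G.Valid) : value G % 2 = (size G : ℤ) % 2 :=
  value_parity _ G rfl hG

/-! ### The lower bound `c(G) ≤ v(G)` for at most one 3-chain -/

lemma tb_chain_le {n : ℕ} {R : Position} (h0 : R ≠ 0) (ht : theta (chain n ::ₘ R) ≤ 1) :
    tb (chain n ::ₘ R) ≤ tb R := by
  rw [theta_chain] at ht
  by_cases hn : n = 3
  · subst hn
    have htR : theta R = 0 := by simpa using ht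
    by_cases ha : AllLoops R
    · rw [tb_six h0 ha, tb_allLoops h0 ha]; norm_num
    · rw [tb_mixed ha htR, tb_four ha htR]
  · have hG : ∀ S, theta S = theta R → theta R = 0 → tb (chain n ::ₘ S) = 4 := by
      intro S h1 h2
      exact tb_four (not_allLoops_chain _ _) (by rw [theta_chain, if_neg hn]; omega)
    rw [if_neg hn] at ht
    rcases Nat.eq_zero_or_pos (theta R) with h | h
    · rw [hG R rfl h]
      by_cases ha : AllLoops R
      · rw [tb_allLoops h0 ha]; norm_num
      · rw [tb_four ha h]
    · obtain ⟨S, rfl, hS⟩ := theta_one (G := R) (by omega)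
      rw [Multiset.cons_swap, tb_mixed (not_allLoops_chain _ _)
        (by rw [theta_chain, if_neg hn]; omega)]
      by_cases hS0 : S = 0
      · subst hS0; rw [tb_three]
      · by_cases ha : AllLoops S
        · rw [tb_six hS0 ha]; norm_num
        · rw [tb_mixed ha hS]

lemma tb_loop {n : ℕ} {R : Position} (h0 : R ≠ 0) (ht : theta R ≤ 1)
    (h3 : R ≠ chain 3 ::ₘ 0) : tb (loop n ::ₘ R) = tb R := by
  rcases Nat.eq_zero_or_pos (theta R) with h | h
  · by_cases ha : AllLoops R
    · rw [tb_allLoops h0 ha, tb_allLoops Multiset.cons_ne_zero ((allLoops_loop _ _).2 ha)]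
    · rw [tb_four ha h, tb_four (fun hh => ha ((allLoops_loop _ _).1 hh)) (by simpa using h)]
  · obtain ⟨S, rfl, hS⟩ := theta_one (G := R) (by omega)
    have hS0 : S ≠ 0 := by rintro rfl; exact h3 rfl
    rw [Multiset.cons_swap]
    by_cases ha : AllLoops S
    · rw [tb_six hS0 ha, tb_six Multiset.cons_ne_zero ((allLoops_loop _ _).2 ha)]
    · rw [tb_mixed ha hS, tb_mixed (fun hh => ha ((allLoops_loop _ _).1 hh)) (by simpa using hS)]

lemma tb_loop_zero {n : ℕ} {R : Position} (h0 : R ≠ 0) (ht : theta R = 0) :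
    tb (loop n ::ₘ R) = tb R := by
  refine tb_loop h0 (by omega) ?_
  rintro rfl
  rw [theta_chain] at ht
  simp at ht

lemma tb_single_loop (n : ℕ) : tb (loop n ::ₘ 0) = 8 :=
  tb_allLoops Multiset.cons_ne_zero (by simp [AllLoops, isLoop])

lemma tb_loop_three (n : ℕ) : tb (loop n ::ₘ chain 3 ::ₘ 0) = 6 := by
  rw [Multiset.cons_swap]
  exact tb_six Multiset.cons_ne_zero (by simp [AllLoops, isLoop])

lemma tb_single_chain (n : ℕ) : tb (chain n ::ₘ 0) = 4 := by
  by_cases hn : n = 3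
  · subst hn; exact tb_three
  · exact tb_four (not_allLoops_chain _ _) (by rw [theta_chain, if_neg hn, theta_zero])

lemma value_lower_aux : ∀ (k : ℕ) (G : Position), Multiset.card G = k → G.Valid →
    theta G ≤ 1 → cval G ≤ value G := by
  intro k
  induction k with
  | zero =>
    intro G hk _ _
    rw [Multiset.card_eq_zero] at hk
    subst hk; simp [value_zero, cval_eq, tb_zero]
  | succ k ih =>
    intro G hk hG ht
    have h0 : G ≠ 0 := by rintro rfl; simp at hk
    rw [cval_eq]
    rcases value_cases hG h0 with ⟨n, R, rfl, h1, hR, h2⟩ | ⟨n, R, rfl, h1, h3, hR, h2⟩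
    · rw [h2, base_chain]
      by_cases hR0 : R = 0
      · subst hR0; rw [tb_single_chain, base_zero, value_zero]; omega
      · have h4 := tb_chain_le hR0 ht
        have h5 := ih R (by simpa using hk) hR (by rw [theta_chain] at ht; omega)
        rw [cval_eq] at h5
        omega
    · rw [h2, base_loop]
      by_cases hR0 : R = 0
      · subst hR0; rw [tb_single_loop, base_zero, value_zero]; omega
      · by_cases hR3 : R = chain 3 ::ₘ 0
        · subst hR3; rw [tb_loop_three, value_three, base_chain, base_zero]; omega
        · have h4 := tb_loop (n := n) hR0 (by simpa using ht) hR3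
          have h5 := ih R (by simpa using hk) hR (by simpa using ht)
          rw [cval_eq] at h5
          omega

lemma value_lower {G : Position} (hG : G.Valid) (ht : theta G ≤ 1) : cval G ≤ value G :=
  value_lower_aux _ G rfl hG ht

/-! ### Upper bounds -/

/-- Without 3-chains and 4-loops the value is at least 2. -/
lemma two_le_value {G : Position} (hG : G.Valid) (h0 : G ≠ 0) (ht : theta G = 0)
    (h4 : loop 4 ∉ G) : 2 ≤ value G := by
  rcases value_cases hG h0 with ⟨n, R, rfl, h1, hR, h2⟩ | ⟨n, R, rfl, h1, h3, hR, h2⟩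
  · have hn : n ≠ 3 := by rintro rfl; simp [theta_chain] at ht
    omega
  · have hn : n ≠ 4 := by rintro rfl; simp at h4
    omega

/-- All loops at least 8 and no 3-chain: `base` is nonnegative. -/
lemma base_nonneg : ∀ (G : Position), G.Valid → theta G = 0 → loop 4 ∉ G → loop 6 ∉ G →
    0 ≤ base G := by
  intro G
  induction G using Multiset.induction_on with
  | empty => simp
  | cons C R ih =>
    intro hG ht h4 h6
    rw [valid_cons] at hG
    simp only [Multiset.mem_cons, not_or] at h4 h6
    cases C with
    | chain n =>
      have h : 3 ≤ n := hG.1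
      rw [theta_chain] at ht
      have := ih hG.2 (by omega) h4.2 h6.2
      have : n ≠ 3 := by rintro rfl; simp at ht
      rw [base_chain]; omega
    | loop n =>
      have h : 4 ≤ n := hG.1.1
      have h' : n % 2 = 0 := Nat.even_iff.mp hG.1.2
      have := ih hG.2 (by simpa using ht) h4.2 h6.2
      have : n ≠ 4 := by rintro rfl; simp at h4
      have : n ≠ 6 := by rintro rfl; simp at h6
      rw [base_loop]; omega

lemma tb_theta_zero {G : Position} (h0 : G ≠ 0) (ht : theta G = 0) :
    tb G = 4 ∨ tb G = 8 := by
  by_cases ha : AllLoops G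
  · exact Or.inr (tb_allLoops h0 ha)
  · exact Or.inl (tb_four ha ht)

lemma value_upper_aux : ∀ (k : ℕ) (G : Position), Multiset.card G = k → G.Valid →
    theta G = 0 → value G ≤ max (cval G) 4 := by
  intro k
  induction k with
  | zero =>
    intro G hk _ _
    rw [Multiset.card_eq_zero] at hk
    subst hk; simp [value_zero]
  | succ k ih =>
    intro G hk hG ht
    have h0 : G ≠ 0 := by rintro rfl; simp at hk
    rw [cval_eq]
    by_cases h4 : loop 4 ∈ G
    · obtain ⟨R, rfl⟩ := Multiset.exists_cons_of_mem h4
      have hv := value_le_loop hG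
      rw [valid_cons] at hG
      by_cases hR0 : R = 0
      · subst hR0; rw [value_zero] at hv; omega
      · have htb := tb_loop_zero (n := 4) hR0 (by simpa using ht)
        have hih := ih R (by simpa using hk) hG.2 (by simpa using ht)
        have := value_nonneg hG.2
        rw [cval_eq] at hih
        rw [base_loop, htb]
        omega
    by_cases h6 : loop 6 ∈ G
    · obtain ⟨R, rfl⟩ := Multiset.exists_cons_of_mem h6
      have hv := value_le_loop hG
      rw [valid_cons] at hG
      by_cases hR0 : R = 0
      · subst hR0; rw [value_zero] at hv
        rw [base_loop, base_zero, tb_single_loop]; omega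
      · have htb := tb_loop_zero (n := 6) hR0 (by simpa using ht)
        have hih := ih R (by simpa using hk) hG.2 (by simpa using ht)
        have := two_le_value hG.2 hR0 (by simpa using ht)
          (fun h => h4 (Multiset.mem_cons_of_mem h))
        rw [cval_eq] at hih
        rw [base_loop, htb]
        omega
    by_cases hl : ∃ n, loop n ∈ G
    · obtain ⟨n, hn⟩ := hl
      obtain ⟨R, rfl⟩ := Multiset.exists_cons_of_mem hn
      have hv := value_le_loop hG
      rw [valid_cons] at hG
      have hn4 : 4 ≤ n := hG.1.1
      by_cases hR0 : R = 0
      · subst hR0; rw [value_zero] at hv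
        rw [base_loop, base_zero, tb_single_loop]; omega
      · have htR : theta R = 0 := by simpa using ht
        have htb := tb_loop_zero (n := n) hR0 htR
        have hih := ih R (by simpa using hk) hG.2 htR
        have hb := base_nonneg R hG.2 htR (fun h => h4 (Multiset.mem_cons_of_mem h))
          (fun h => h6 (Multiset.mem_cons_of_mem h))
        have hlow := value_lower hG.2 (by omega)
        have htb2 := tb_theta_zero hR0 htR
        rw [cval_eq] at hih hlow
        rw [base_loop, htb]
        omega
    · obtain ⟨C, hC⟩ := Multiset.exists_mem_of_ne_zero h0
      cases C with
      | loop n => exact absurd ⟨n, hC⟩ hl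
      | chain n =>
        obtain ⟨R, rfl⟩ := Multiset.exists_cons_of_mem hC
        have hv := value_le_chain hG
        rw [valid_cons] at hG
        have htR : theta R = 0 := by rw [theta_chain] at ht; omega
        have htb := tb_four (not_allLoops_chain n R) ht
        have hn : 3 ≤ n := hG.1
        by_cases hR0 : R = 0
        · subst hR0; rw [value_zero] at hv
          rw [base_chain, base_zero, htb]; omega
        · have hih := ih R (by simpa using hk) hG.2 htR
          have hb := base_nonneg R hG.2 htR (fun h => h4 (Multiset.mem_cons_of_mem h))
            (fun h => h6 (Multiset.mem_cons_of_mem h))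
          have hlow := value_lower hG.2 (by omega)
          have htbR : tb R = 4 := by
            refine tb_four (fun ha => ?_) htR
            obtain ⟨D, hD⟩ := Multiset.exists_mem_of_ne_zero hR0
            cases D with
            | loop m => exact hl ⟨m, Multiset.mem_cons_of_mem hD⟩
            | chain m => simpa [isLoop] using ha _ hD
          rw [cval_eq] at hih hlow
          rw [base_chain, htb]
          omega

lemma value_upper {G : Position} (hG : G.Valid) (ht : theta G = 0) :
    value G ≤ max (cval G) 4 := value_upper_aux _ G rfl hG ht

/-- Upper bound for a 3-chain plus a nonempty collection of loops. -/
lemma value_upper_six : ∀ (k : ℕ) (R : Position), Multiset.card R = k → R.Valid → R ≠ 0 →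
    AllLoops R → size R % 2 = 0 → value (chain 3 ::ₘ R) ≤ max (base R + 5) 5 := by
  intro k
  induction k with
  | zero =>
    intro R hk _ h0
    exact absurd (Multiset.card_eq_zero.mp hk) h0
  | succ k ih =>
    intro G hk hG h0 ha hs
    have hv3 : (chain 3).Valid := by simp [Component.Valid]
    have key : ∀ n, loop n ∈ G → ∃ R, G = loop n ::ₘ R ∧ 4 ≤ n ∧ Multiset.card R = k ∧
        Position.Valid R ∧ AllLoops R ∧ size R % 2 = 0 ∧ value (chain 3 ::ₘ G) ≤
          (n : ℤ) - 4 + max (value (chain 3 ::ₘ R) - 4) (4 - value (chain 3 ::ₘ R)) := by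
      intro n hn
      obtain ⟨R, rfl⟩ := Multiset.exists_cons_of_mem hn
      have hG' := valid_cons.1 hG
      have hne : n % 2 = 0 := Nat.even_iff.mp hG'.1.2
      refine ⟨R, rfl, hG'.1.1, by simpa using hk, hG'.2, (allLoops_loop _ _).1 ha, ?_, ?_⟩
      · rw [size_loop] at hs; omega
      · rw [Multiset.cons_swap]
        exact value_le_loop (valid_cons.2 ⟨hG'.1, valid_cons.2 ⟨hv3, hG'.2⟩⟩)
    have fin : ∀ n, loop n ∈ G → (n = 4 ∨ n = 6 ∨ (loop 4 ∉ G ∧ loop 6 ∉ G)) →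
        value (chain 3 ::ₘ G) ≤ max (base G + 5) 5 := by
      intro n hn hcase
      obtain ⟨R, rfl, hn4, hkR, hR, haR, hsR, hv⟩ := key n hn
      rw [base_loop]
      by_cases hR0 : R = 0
      · subst hR0
        rw [value_three] at hv
        rw [base_zero]
        omega
      · have hih := ih R hkR hR hR0 haR hsR
        have htR := allLoops_theta haR
        have hvR : Position.Valid (chain 3 ::ₘ R) := valid_cons.2 ⟨hv3, hR⟩
        have hlow := value_lower hvR (by rw [theta_chain, htR]; simp)
        have hpar := parity hvR
        rw [size_chain] at hpar
        push_cast at hpar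
        have hnn := value_nonneg hvR
        rw [cval_eq, base_chain, tb_six hR0 haR] at hlow
        push_cast at hlow
        rcases hcase with rfl | rfl | ⟨h4, h6⟩
        · omega
        · omega
        · have hb := base_nonneg R hR htR (fun h => h4 (Multiset.mem_cons_of_mem h))
            (fun h => h6 (Multiset.mem_cons_of_mem h))
          omega
    by_cases h4 : loop 4 ∈ G
    · exact fin 4 h4 (Or.inl rfl)
    by_cases h6 : loop 6 ∈ G
    · exact fin 6 h6 (Or.inr (Or.inl rfl))
    obtain ⟨C, hC⟩ := Multiset.exists_mem_of_ne_zero h0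
    cases C with
    | chain n => simpa [isLoop] using ha _ hC
    | loop n => exact fin n hC (Or.inr (Or.inr ⟨h4, h6⟩))

/-! ### Without 3-chains, even values agree with the size modulo 4 -/

set_option maxHeartbeats 4000000 in
lemma value_mod_four : ∀ (k : ℕ) (G : Position), Multiset.card G = k → G.Valid →
    theta G = 0 → size G % 2 = 0 → value G % 4 = (size G : ℤ) % 4 := by
  intro k
  induction k using Nat.strong_induction_on with
  | _ k ih =>
    intro G hk hG ht hs
    by_cases h0 : G = 0
    · subst h0; simp [value_zero]
    have hnn := value_nonneg hG
    have hpar := parity hG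
    by_cases hbig : 5 ≤ value G
    · have h1 := value_upper hG ht
      have h2 := value_lower hG (by omega)
      rw [cval_eq] at h1 h2
      have h3 := base_mod G
      have h4 := tb_theta_zero h0 ht
      omega
    rcases value_cases hG h0 with ⟨n, R, rfl, h1, hR, h2⟩ | ⟨n, R, rfl, h1, h3, hR, h2⟩
    · have hn3 : n ≠ 3 := by rintro rfl; simp [theta_chain] at ht
      have htR : theta R = 0 := by rw [theta_chain] at ht; omega
      have hkR : Multiset.card R + 1 = k := by simpa using hk
      rw [size_chain] at hs hpar ⊢
      push_cast at hpar ⊢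
      have hnR := value_nonneg hR
      by_cases hn5 : n = 5
      · subst hn5
        by_contra hbad
        have hR0 : R ≠ 0 := by rintro rfl; simp at hs
        have hv5 : (chain 5).Valid := by simp [Component.Valid]
        have ht5 : ∀ S, theta (chain 5 ::ₘ S) = theta S := by intro S; simp [theta_chain]
        have hparR := parity hR
        rcases value_cases hR hR0 with ⟨m, S, rfl, g1, hS, g2⟩ | ⟨m, S, rfl, g1, g3, hS, g2⟩
        · have hm3 : m ≠ 3 := by rintro rfl; simp [theta_chain] at htR
          have htS : theta S = 0 := by rw [theta_chain] at htR; omega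
          have hkS : Multiset.card S + 2 = k := by simp at hkR; omega
          have hv' : Position.Valid (chain 5 ::ₘ S) := valid_cons.2 ⟨hv5, hS⟩
          have e1 := value_le_chain hv'
          have hG' := hG
          rw [Multiset.cons_swap] at hG'
          have e2 := value_le_chain hG'
          rw [Multiset.cons_swap] at e2
          have e3 := value_nonneg hv'
          rw [size_chain] at hs hpar hbad hparR
          push_cast at hpar hbad hparR
          by_cases hm5 : m = 5
          · have e5 := ih (Multiset.card S) (by omega) S rfl hS htS (by omega)
            omega
          · have hm4 : m = 4 := by omega
            subst hm4
            have e4 := ih (Multiset.card S + 1) (by omega) (chain 5 ::ₘ S) (by simp) hv'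
              (by rw [ht5, htS]) (by rw [size_chain]; omega)
            rw [size_chain] at e4
            push_cast at e4
            omega
        · have htS : theta S = 0 := by simpa using htR
          have hkS : Multiset.card S + 2 = k := by simp at hkR; omega
          have hv' : Position.Valid (chain 5 ::ₘ S) := valid_cons.2 ⟨hv5, hS⟩
          have e1 := value_le_chain hv'
          have hG' := hG
          rw [Multiset.cons_swap] at hG'
          have e2 := value_le_loop hG'
          rw [Multiset.cons_swap] at e2
          have e3 := value_nonneg hv'
          rw [size_loop] at hs hpar hbad hparR
          push_cast at hpar hbad hparR
          have e4 := ih (Multiset.card S + 1) (by omega) (chain 5 ::ₘ S) (by simp) hv'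
              (by rw [ht5, htS]) (by rw [size_chain]; omega)
          rw [size_chain] at e4
          push_cast at e4
          have hm : m = 4 ∨ m = 6 := by omega
          rcases hm with rfl | rfl
          · omega
          · have e5 : value (chain 5 ::ₘ S) = 0 := by omega
            rcases value_cases hv' Multiset.cons_ne_zero with
              ⟨p, T, hT, p1, hTv, p2⟩ | ⟨p, T, hT, p1, p3, hTv, p2⟩
            · omega
            · have hp : p = 4 := by omega
              subst hp
              have hT6 : Position.Valid (loop 6 ::ₘ T) :=
                valid_cons.2 ⟨(valid_cons.1 hG').1, hTv⟩
              have hL4 : (loop 4).Valid := by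
                rw [hT] at hv'; exact (valid_cons.1 hv').1
              have q1 := value_le_loop hT6
              have q2 := value_le_loop (valid_cons.2 ⟨hL4, hT6⟩)
              have hEq : (loop 4 ::ₘ loop 6 ::ₘ T : Position) = chain 5 ::ₘ loop 6 ::ₘ S := by
                rw [Multiset.cons_swap, ← hT, Multiset.cons_swap]
              rw [hEq] at q2
              have hszT := congrArg size hT
              have hthT := congrArg theta hT
              have hcT := congrArg Multiset.card hT
              rw [size_chain, size_loop] at hszT
              rw [ht5, theta_loop] at hthT
              simp only [Multiset.card_cons] at hcT
              have q3 := ih (Multiset.card T + 1) (by omega) (loop 6 ::ₘ T) (by simp) hT6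
                (by rw [theta_loop]; omega) (by rw [size_loop]; omega)
              rw [size_loop] at q3
              push_cast at q3
              have q4 := value_nonneg hT6
              omega
      · have hn : n = 4 ∨ n = 6 := by omega
        have := ih (Multiset.card R) (by omega) R rfl hR htR (by omega)
        omega
    · have htR : theta R = 0 := by simpa using ht
      have hkR : Multiset.card R + 1 = k := by simpa using hk
      rw [size_loop] at hs ⊢
      push_cast
      have := ih (Multiset.card R) (by omega) R rfl hR htR (by omega)
      omega

/-! ### The main theorem -/

lemma cval_odd {G : Position} (ht : theta G = 1) (hs : size G % 2 = 1) :
    cval G % 2 = 1 := by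
  obtain ⟨R, rfl, hR⟩ := theta_one ht
  have h1 := base_mod (chain 3 ::ₘ R)
  rw [cval_eq]
  by_cases h0 : R = 0
  · subst h0; rw [tb_three]; omega
  · by_cases ha : AllLoops R
    · rw [tb_six h0 ha]; omega
    · rw [tb_mixed ha hR]; omega

/-- The value cannot be 1 unless a suitable 4-loop can be opened. -/
lemma value_ne_one {G : Position} (hG : G.Valid) (ht : theta G = 1) (hs : size G % 4 = 3)
    (h : ∀ R, G = loop 4 ::ₘ R → value R ≠ 3 ∧ value R ≠ 5) : value G ≠ 1 := by
  intro h1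
  have h0 : G ≠ 0 := by rintro rfl; simp at ht
  rcases value_cases hG h0 with ⟨n, R, rfl, g1, hR, g2⟩ | ⟨n, R, rfl, g1, g3, hR, g2⟩
  · have hn : n = 3 := by omega
    subst hn
    rw [size_chain] at hs
    have := value_mod_four _ R rfl hR (by simpa [theta_chain] using ht) (by omega)
    omega
  · have hn : n = 4 := by omega
    subst hn
    have := h R rfl
    omega

/-- Positions with controlled value 3 or 5. -/
lemma value_mid {G : Position} (hG : G.Valid) (ht : theta G = 1) (hs : size G % 4 = 3)
    (hc : cval G = 3 ∨ cval G = 5) : value G = 3 ∨ value G = 5 := by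
  have hlow := value_lower hG (by omega)
  have hpar := parity hG
  suffices value G ≤ 5 by omega
  obtain ⟨R, rfl, hR⟩ := theta_one ht
  have hRv := (valid_cons.1 hG).2
  rw [cval_eq, base_chain] at hc
  rw [size_chain] at hs
  by_cases h0 : R = 0
  · subst h0; rw [value_three]; norm_num
  · by_cases ha : AllLoops R
    · have := value_upper_six _ R rfl hRv h0 ha (by omega)
      rw [tb_six h0 ha] at hc
      push_cast at hc
      omega
    · have h1 := value_upper hRv hR
      have h2 := value_le_chain hG
      have h3 := value_nonneg hRv
      rw [cval_eq, tb_four ha hR] at h1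
      rw [tb_mixed ha hR] at hc
      push_cast at hc h2
      omega

/-- No 4-loops. -/
lemma value_no_four {G : Position} (hG : G.Valid) (ht : theta G = 1) (hs : size G % 4 = 3)
    (hc : cval G < 2) (h4 : loop 4 ∉ G) : value G = 3 := by
  have h1 := value_ne_one hG ht hs (by rintro R rfl; simp at h4)
  have hpar := parity hG
  have hnn := value_nonneg hG
  suffices value G ≤ 3 by omega
  obtain ⟨R, rfl, hR⟩ := theta_one ht
  have hRv := (valid_cons.1 hG).2
  rw [cval_eq, base_chain] at hc
  rw [size_chain] at hs
  by_cases h0 : R = 0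
  · subst h0; rw [value_three]
  · have h2 := value_upper hRv hR
    have h3 := value_le_chain hG
    have h5 := value_nonneg hRv
    have h6 := value_mod_four _ R rfl hRv hR (by omega)
    have h7 := base_mod R
    rw [cval_eq] at h2
    push_cast at hc h3
    by_cases ha : AllLoops R
    · rw [tb_six h0 ha] at hc
      rw [tb_allLoops h0 ha] at h2
      omega
    · rw [tb_mixed ha hR] at hc
      rw [tb_four ha hR] at h2
      omega

lemma main_aux : ∀ (k : ℕ) (G : Position), numF G = k → G.Valid → theta G = 1 →
    size G % 4 = 3 → cval G < 2 →
    (loop 4 ∈ G → Optimal G (loop 4)) ∧ (value G = 1 ∨ value G = 3) ∧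
    (2 ≤ cval G + 4 * (k : ℤ) →
      (cval G % 8 = 1 ∨ cval G % 8 = 7 → value G = 1) ∧
      (cval G % 8 = 3 ∨ cval G % 8 = 5 → value G = 3)) ∧
    (cval G + 4 * (k : ℤ) < 2 →
      (k % 2 = 1 → value G = 1) ∧ (k % 2 = 0 → value G = 3)) := by
  intro k
  induction k with
  | zero =>
    intro G hk hG ht hs hc
    have h4 : loop 4 ∉ G := by rw [numF, Multiset.count_eq_zero] at hk; exact hk
    have hv := value_no_four hG ht hs hc h4
    refine ⟨fun h => absurd h h4, Or.inr hv, ?_, ?_⟩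
    · intro h; push_cast at h; omega
    · intro _; exact ⟨fun h => by omega, fun _ => hv⟩
  | succ k ih =>
    intro G hk hG ht hs hc
    have h4 : loop 4 ∈ G := by
      rw [numF] at hk; exact Multiset.count_pos.mp (by omega)
    obtain ⟨R, rfl⟩ := Multiset.exists_cons_of_mem h4
    have hRv := (valid_cons.1 hG).2
    have htR : theta R = 1 := by simpa using ht
    have hkR : numF R = k := by simpa using hk
    have hsR : size R % 4 = 3 := by rw [size_loop] at hs; omega
    have hR0 : R ≠ 0 := by rintro rfl; simp at htR
    have hodd := cval_odd htR (by omega)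
    have hle := value_le_loop hG
    have hpar := parity hG
    have hnn := value_nonneg hG
    have hne : value R = 1 → value (loop 4 ::ₘ R) ≠ 1 := by
      intro h1
      refine value_ne_one hG ht hs ?_
      intro S hS
      rw [Multiset.cons_inj_right] at hS
      subst hS
      omega
    -- the value and optimality in terms of the value of the rest
    have step : value R = 1 ∨ value R = 3 ∨ value R = 5 →
        Optimal (loop 4 ::ₘ R) (loop 4) ∧ (value R = 1 → value (loop 4 ::ₘ R) = 3) ∧
        (value R ≠ 1 → value (loop 4 ::ₘ R) = 1) := by
      intro h
      have a : (value R = 1 → value (loop 4 ::ₘ R) = 3) ∧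
        (value R ≠ 1 → value (loop 4 ::ₘ R) = 1) := by
        push_cast at hle
        constructor
        · intro h1; have := hne h1; omega
        · intro h1; omega
      refine ⟨⟨h4, ?_⟩, a⟩
      rw [valueOpen, Multiset.erase_cons_head, openVal, abs_four]
      push_cast
      omega
    by_cases hR3 : R = chain 3 ::ₘ 0
    · subst hR3
      rw [value_three] at step
      obtain ⟨s1, -, s2⟩ := step (by omega)
      have s3 := s2 (by omega)
      have hcv : cval (loop 4 ::ₘ chain 3 ::ₘ 0) = 1 := by
        rw [cval_eq, tb_loop_three, base_loop, base_chain, base_zero]; norm_num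
      rw [hcv]
      exact ⟨fun _ => s1, Or.inl s3, fun _ => ⟨fun _ => s3, by omega⟩, by push_cast; omega⟩
    · have hcR : cval R = cval (loop 4 ::ₘ R) + 4 := by
        rw [cval_eq, cval_eq, tb_loop hR0 (by omega) hR3, base_loop]; push_cast; ring
      by_cases hbig : cval R < 2
      · obtain ⟨-, i1, i2, i3⟩ := ih R hkR hRv htR hsR hbig
        obtain ⟨s1, s2, s3⟩ := step (by omega)
        refine ⟨fun _ => s1, by omega, ?_, ?_⟩
        · push_cast; omega
        · push_cast; omega
      · have hm := value_mid hRv htR hsR (by omega)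
        obtain ⟨s1, -, s3⟩ := step (by omega)
        refine ⟨fun _ => s1, by omega, ?_, ?_⟩
        · push_cast; omega
        · push_cast; omega

/-- Third example of 4-loop optimality: G has exactly one 3-chain, size(G) ≡ 3 mod 4,
and c(G) < 2. If G has a 4-loop then opening it is optimal, and v(G) is as described. -/
theorem four_loop_optimality_three (G : Position) (hG : G.Valid)
    (hth : theta G = 1) (hsz : size G % 4 = 3) (hc : cval G < 2) :
    (Component.loop 4 ∈ G → Optimal G (Component.loop 4)) ∧
    (2 ≤ cval G + 4 * (numF G : ℤ) →
      (cval G % 8 = 1 ∨ cval G % 8 = 7 → value G = 1) ∧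
      (cval G % 8 = 3 ∨ cval G % 8 = 5 → value G = 3)) ∧
    (cval G + 4 * (numF G : ℤ) < 2 →
      (Odd (numF G) → value G = 1) ∧ (Even (numF G) → value G = 3)) := by
  obtain ⟨h1, -, h2, h3⟩ := main_aux _ G rfl hG hth hsz hc
  rw [Nat.odd_iff, Nat.even_iff]
  exact ⟨h1, h2, h3⟩

end DotsAndBoxes
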